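/- For every real constant c > 0, the worst-case risk of the Good-Turing estimator satisfies liminf_{n→∞} n·sup_p R_n(M^GT, p) ≥ (1/c + 1)·e^{−1/c} − e^{−2/c}, where the supremum is over all probability mass functions p on ℕ. -/

import Mathlib

open scoped BigOperators

noncomputable section

/-- `p` is a probability mass function on `ℕ`. -/
def IsPMF (p : ℕ → ℝ) : Prop := (∀ u, 0 ≤ p u) ∧ HasSum p 1

/-- `N_u(X^n)`: the number of appearances of the symbol `u` in the sample `x`. -/
def nOcc {n : ℕ} (x : Fin n → ℕ) (u : ℕ) : ℕ :=
  (Finset.univ.filter fun i => x i = u).card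

/-- Probability of the sample `x` under the `n`-fold product measure `p^⊗n`. -/
def sampleProb {n : ℕ} (p : ℕ → ℝ) (x : Fin n → ℕ) : ℝ := ∏ i, p (x i)

/-- Expectation of `f(X^n)` for `X^n ∼ p^⊗n`. -/
def expct (n : ℕ) (p : ℕ → ℝ) (f : (Fin n → ℕ) → ℝ) : ℝ :=
  ∑' x : Fin n → ℕ, sampleProb p x * f x

/-- The missing mass `M₀(X^n) = ∑_u p(u) 𝟙[N_u(X^n) = 0]`. -/
def missingMass {n : ℕ} (p : ℕ → ℝ) (x : Fin n → ℕ) : ℝ :=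
  ∑' u : ℕ, if nOcc x u = 0 then p u else 0

/-- `Φ_i(X^n)`: the number of symbols appearing exactly `i` times in `x` (for `i ≥ 1`). -/
def phi {n : ℕ} (i : ℕ) (x : Fin n → ℕ) : ℕ :=
  ((Finset.univ.image x).filter fun u => nOcc x u = i).card

/-- The Good-Turing estimator `M^GT(X^n) = Φ₁(X^n)/n`. -/
def goodTuring {n : ℕ} (x : Fin n → ℕ) : ℝ := (phi 1 x : ℝ) / n

/-- The squared-error risk `R_n(M̂, p) = E[(M̂(X^n) - M₀(X^n))²]`. -/
def risk (n : ℕ) (p : ℕ → ℝ) (M : (Fin n → ℕ) → ℝ) : ℝ :=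
  expct n p fun x => (M x - missingMass p x) ^ 2

/-- The worst-case risk of the Good-Turing estimator, `sup_p R_n(M^GT, p)`. -/
def gtWorstRisk (n : ℕ) : ℝ :=
  sSup {r : ℝ | ∃ p : ℕ → ℝ, IsPMF p ∧ r = risk n p goodTuring}

open MeasureTheory

/-- The measure on `ℕ` with point masses `p`. -/
def pmfMeasure (p : ℕ → ℝ) : Measure ℕ :=
  Measure.sum fun u => ENNReal.ofReal (p u) • Measure.dirac u

/-- The law of `n` i.i.d. samples from `p`. -/
def sampleMeasure (n : ℕ) (p : ℕ → ℝ) : Measure (Fin n → ℕ) :=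
  Measure.pi fun _ => pmfMeasure p

lemma pmfMeasure_singleton (p : ℕ → ℝ) (u : ℕ) :
    pmfMeasure p {u} = ENNReal.ofReal (p u) := by
  rw [pmfMeasure, Measure.sum_apply _ (measurableSet_singleton u), tsum_eq_single u]
  · simp
  · intro v hv
    simp [hv]

lemma IsPMF.isProbabilityMeasure {p : ℕ → ℝ} (hp : IsPMF p) :
    IsProbabilityMeasure (pmfMeasure p) := by
  constructor
  rw [pmfMeasure, Measure.sum_apply _ MeasurableSet.univ]
  simp [← ENNReal.ofReal_tsum_of_nonneg hp.1 hp.2.summable, hp.2.tsum_eq]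

lemma IsPMF.isProbabilityMeasure_sampleMeasure {p : ℕ → ℝ} (hp : IsPMF p) (n : ℕ) :
    IsProbabilityMeasure (sampleMeasure n p) := by
  have := hp.isProbabilityMeasure
  unfold sampleMeasure
  infer_instance

lemma IsPMF.measureReal_singleton {p : ℕ → ℝ} (hp : IsPMF p) (u : ℕ) :
    (pmfMeasure p).real {u} = p u := by
  rw [measureReal_def, pmfMeasure_singleton, ENNReal.toReal_ofReal (hp.1 u)]

lemma IsPMF.measureReal_compl_singleton {p : ℕ → ℝ} (hp : IsPMF p) (u : ℕ) :
    (pmfMeasure p).real {u}ᶜ = 1 - p u := by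
  have := hp.isProbabilityMeasure
  rw [measureReal_compl (measurableSet_singleton u), hp.measureReal_singleton, probReal_univ]

lemma IsPMF.measureReal_compl_pair {p : ℕ → ℝ} (hp : IsPMF p) {u v : ℕ} (huv : u ≠ v) :
    (pmfMeasure p).real {u, v}ᶜ = 1 - p u - p v := by
  have := hp.isProbabilityMeasure
  rw [measureReal_compl (Set.toFinite _).measurableSet, probReal_univ, Set.insert_eq,
    measureReal_union (by simpa using huv) (measurableSet_singleton v),
    hp.measureReal_singleton, hp.measureReal_singleton]
  ring

lemma integrable_sampleMeasure_of_bound {n : ℕ} {p : ℕ → ℝ} (hp : IsPMF p)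
    {f : (Fin n → ℕ) → ℝ} (C : ℝ) (hf : ∀ x, |f x| ≤ C) : Integrable f (sampleMeasure n p) := by
  have := hp.isProbabilityMeasure_sampleMeasure n
  exact Integrable.of_bound (measurable_of_countable f).aestronglyMeasurable C
    (Filter.Eventually.of_forall hf)

lemma expct_eq_integral {n : ℕ} {p : ℕ → ℝ} (hp : IsPMF p) {f : (Fin n → ℕ) → ℝ}
    (hf : Integrable f (sampleMeasure n p)) :
    expct n p f = ∫ x, f x ∂(sampleMeasure n p) := by
  have := hp.isProbabilityMeasure
  rw [integral_countable hf, expct]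
  refine tsum_congr fun x => ?_
  rw [smul_eq_mul, sampleProb, sampleMeasure, measureReal_def, Measure.pi_singleton,
    ENNReal.toReal_prod]
  congr 1
  exact Finset.prod_congr rfl fun i _ => (hp.measureReal_singleton (x i)).symm

open Classical in
lemma integral_box {n : ℕ} {p : ℕ → ℝ} (hp : IsPMF p) (s : Fin n → Set ℕ) :
    ∫ x, (if ∀ i, x i ∈ s i then (1 : ℝ) else 0) ∂(sampleMeasure n p) =
      ∏ i, (pmfMeasure p).real (s i) := by
  have := hp.isProbabilityMeasure
  have h : (fun x : Fin n → ℕ => if ∀ i, x i ∈ s i then (1 : ℝ) else 0) =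
      (Set.univ.pi s).indicator 1 := by
    ext x
    simp [Set.indicator_apply, Set.mem_pi]
  rw [h, integral_indicator_one (Set.to_countable _).measurableSet, measureReal_def,
    sampleMeasure, Measure.pi_pi, ENNReal.toReal_prod]
  rfl

lemma prod_ite_eq_mul_pow {n : ℕ} (j : Fin n) (a b : ℝ) :
    ∏ i, (if i = j then a else b) = a * b ^ (n - 1) := by
  rw [Finset.prod_ite]
  simp [Finset.filter_eq', Finset.filter_ne']

lemma prod_ite_ite_eq_mul_pow {n : ℕ} {j k : Fin n} (hjk : j ≠ k) (a b c : ℝ) :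
    ∏ i, (if i = j then a else if i = k then b else c) = a * b * c ^ (n - 2) := by
  rw [← Finset.mul_prod_erase Finset.univ _ (Finset.mem_univ j),
    ← Finset.mul_prod_erase (Finset.univ.erase j) _
      (Finset.mem_erase.2 ⟨hjk.symm, Finset.mem_univ k⟩),
    Finset.prod_congr rfl (g := fun _ => c)]
  · simp [hjk.symm, mul_assoc, Finset.card_erase_of_mem, Nat.sub_sub]
  · intro i hi
    simp only [Finset.mem_erase, Finset.mem_univ, and_true] at hi
    simp [hi.1, hi.2]

lemma nOcc_eq_zero_iff {n : ℕ} (x : Fin n → ℕ) (u : ℕ) : nOcc x u = 0 ↔ ∀ i, x i ≠ u := by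
  simp [nOcc, Finset.filter_eq_empty_iff]

lemma nOcc_eq_one_iff {n : ℕ} (x : Fin n → ℕ) (u : ℕ) :
    nOcc x u = 1 ↔ ∃ j, ∀ i, x i = u ↔ i = j := by
  simp [nOcc, Finset.card_eq_one, Finset.ext_iff]

open Classical in
lemma ite_nOcc_eq_one {n : ℕ} (x : Fin n → ℕ) (u : ℕ) :
    (if nOcc x u = 1 then (1 : ℝ) else 0) =
      ∑ j, if ∀ i, x i = u ↔ i = j then (1 : ℝ) else 0 := by
  split_ifs with h
  · obtain ⟨j, hj⟩ := (nOcc_eq_one_iff x u).1 h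
    rw [Finset.sum_eq_single j]
    · simp [hj]
    · intro k _ hk
      rw [if_neg]
      intro h'
      exact hk ((hj k).1 ((h' k).2 rfl))
    · simp
  · symm
    refine Finset.sum_eq_zero fun j _ => if_neg fun hj => h ((nOcc_eq_one_iff x u).2 ⟨j, hj⟩)

lemma integral_nOcc_eq_zero {p : ℕ → ℝ} (hp : IsPMF p) (n u : ℕ) :
    ∫ x : Fin n → ℕ, (if nOcc x u = 0 then (1 : ℝ) else 0) ∂(sampleMeasure n p) =
      (1 - p u) ^ n := by
  classical
  have h := integral_box hp (fun _ : Fin n => {u}ᶜ)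
  simp only [hp.measureReal_compl_singleton, Finset.prod_const, Finset.card_univ,
    Fintype.card_fin] at h
  rw [← h]
  congr! 3 with x
  simp [nOcc_eq_zero_iff]

lemma integral_nOcc_eq_one {p : ℕ → ℝ} (hp : IsPMF p) (n u : ℕ) :
    ∫ x : Fin n → ℕ, (if nOcc x u = 1 then (1 : ℝ) else 0) ∂(sampleMeasure n p) =
      n * (p u * (1 - p u) ^ (n - 1)) := by
  classical
  simp_rw [ite_nOcc_eq_one]
  rw [integral_finsetSum]
  · rw [Finset.sum_congr rfl (g := fun _ => p u * (1 - p u) ^ (n - 1))]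
    · simp
    intro j _
    have h := integral_box hp (fun i : Fin n => if i = j then {u} else {u}ᶜ)
    simp only [apply_ite (pmfMeasure p).real, hp.measureReal_singleton,
      hp.measureReal_compl_singleton, prod_ite_eq_mul_pow] at h
    rw [← h]
    congr! 4 with x i
    split_ifs with hi <;> simp [hi]
  · intro j _
    refine integrable_sampleMeasure_of_bound hp 1 fun x => ?_
    split_ifs <;> simp

lemma integral_nOcc_eq_zero_zero {p : ℕ → ℝ} (hp : IsPMF p) (n : ℕ) {u v : ℕ} (huv : u ≠ v) :
    ∫ x : Fin n → ℕ, (if nOcc x u = 0 then (1 : ℝ) else 0) * (if nOcc x v = 0 then 1 else 0)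
      ∂(sampleMeasure n p) = (1 - p u - p v) ^ n := by
  classical
  have h := integral_box hp (fun _ : Fin n => {u, v}ᶜ)
  simp only [hp.measureReal_compl_pair huv, Finset.prod_const, Finset.card_univ,
    Fintype.card_fin] at h
  rw [← h]
  congr! 2 with x
  rw [ite_zero_mul_ite_zero, one_mul]
  congr! 1
  simp [nOcc_eq_zero_iff, forall_and]

lemma integral_nOcc_eq_one_zero {p : ℕ → ℝ} (hp : IsPMF p) (n : ℕ) {u v : ℕ} (huv : u ≠ v) :
    ∫ x : Fin n → ℕ, (if nOcc x u = 1 then (1 : ℝ) else 0) * (if nOcc x v = 0 then 1 else 0)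
      ∂(sampleMeasure n p) = n * (p u * (1 - p u - p v) ^ (n - 1)) := by
  classical
  simp_rw [ite_nOcc_eq_one, Finset.sum_mul, ite_zero_mul_ite_zero, one_mul]
  rw [integral_finsetSum]
  · rw [Finset.sum_congr rfl (g := fun _ => p u * (1 - p u - p v) ^ (n - 1))]
    · simp
    intro j _
    have h := integral_box hp (fun i : Fin n => if i = j then {u} else {u, v}ᶜ)
    simp only [apply_ite (pmfMeasure p).real, hp.measureReal_singleton,
      hp.measureReal_compl_pair huv, prod_ite_eq_mul_pow] at h
    rw [← h]
    congr! 3 with x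
    rw [nOcc_eq_zero_iff, ← forall_and]
    congr! 2 with i
    split_ifs with hi
    · simpa [hi] using fun h => h ▸ huv
    · simp [hi]
  · intro j _
    refine integrable_sampleMeasure_of_bound hp 1 fun x => ?_
    split_ifs <;> simp

lemma integral_nOcc_eq_one_one {p : ℕ → ℝ} (hp : IsPMF p) (n : ℕ) {u v : ℕ} (huv : u ≠ v) :
    ∫ x : Fin n → ℕ, (if nOcc x u = 1 then (1 : ℝ) else 0) * (if nOcc x v = 1 then 1 else 0)
      ∂(sampleMeasure n p) = n * (n - 1) * (p u * p v * (1 - p u - p v) ^ (n - 2)) := by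
  classical
  simp_rw [ite_nOcc_eq_one, Finset.sum_mul_sum, ite_zero_mul_ite_zero, one_mul]
  have hint : ∀ j k : Fin n, Integrable (fun x : Fin n → ℕ =>
      if (∀ i, x i = u ↔ i = j) ∧ (∀ i, x i = v ↔ i = k) then (1 : ℝ) else 0)
      (sampleMeasure n p) := by
    intro j k
    refine integrable_sampleMeasure_of_bound hp 1 fun x => ?_
    split_ifs <;> simp
  rw [integral_finsetSum _ fun j _ => integrable_finsetSum _ fun k _ => hint j k]
  simp_rw [integral_finsetSum _ fun k _ => hint _ k]
  have hjk : ∀ j k : Fin n, ∫ x : Fin n → ℕ,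
      (if (∀ i, x i = u ↔ i = j) ∧ (∀ i, x i = v ↔ i = k) then (1 : ℝ) else 0)
      ∂(sampleMeasure n p) = if j = k then 0 else p u * p v * (1 - p u - p v) ^ (n - 2) := by
    intro j k
    split_ifs with hjk
    · subst hjk
      rw [integral_eq_zero_of_ae]
      refine Filter.Eventually.of_forall fun x => if_neg ?_
      rintro ⟨h1, h2⟩
      exact huv (((h1 j).2 rfl).symm.trans ((h2 j).2 rfl))
    have h := integral_box hp
      (fun i : Fin n => if i = j then {u} else if i = k then {v} else {u, v}ᶜ)
    simp only [apply_ite (pmfMeasure p).real, hp.measureReal_singleton,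
      hp.measureReal_compl_pair huv, prod_ite_ite_eq_mul_pow hjk] at h
    rw [← h]
    congr! 3 with x
    rw [← forall_and]
    congr! 2 with i
    split_ifs with hi hi'
    · subst hi
      simpa [hjk] using fun h => h ▸ huv
    · subst hi'
      simpa [hi] using fun h => h ▸ huv.symm
    · simp [hi, hi']
  simp_rw [hjk, Finset.sum_ite, Finset.sum_const_zero, zero_add, Finset.sum_const,
    Finset.filter_ne, Finset.card_erase_of_mem (Finset.mem_univ _), Finset.sum_const]
  rcases n with _ | n
  · simp
  · simp
    ring

/-- The contribution of the symbol `u` to `Φ₁/n + s * M₀`. -/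
def symbolTerm {n : ℕ} (s : ℝ) (p : ℕ → ℝ) (u : ℕ) (x : Fin n → ℕ) : ℝ :=
  (n : ℝ)⁻¹ * (if nOcc x u = 1 then 1 else 0) + s * p u * (if nOcc x u = 0 then 1 else 0)

/-- The second moments of the symbol contributions, `E[symbolTerm u * symbolTerm v]`. -/
def termMoment (n : ℕ) (s : ℝ) (p : ℕ → ℝ) (z : ℕ × ℕ) : ℝ :=
  if z.1 = z.2 then
    p z.1 * (1 - p z.1) ^ (n - 1) / n + s ^ 2 * p z.1 ^ 2 * (1 - p z.1) ^ n
  else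
    p z.1 * p z.2 * ((1 - (n : ℝ)⁻¹) * (1 - p z.1 - p z.2) ^ (n - 2)
      + 2 * s * (1 - p z.1 - p z.2) ^ (n - 1) + s ^ 2 * (1 - p z.1 - p z.2) ^ n)

lemma integral_symbolTerm_mul {n : ℕ} (hn : n ≠ 0) (s : ℝ) {p : ℕ → ℝ} (hp : IsPMF p)
    (z : ℕ × ℕ) :
    ∫ x : Fin n → ℕ, symbolTerm s p z.1 x * symbolTerm s p z.2 x ∂(sampleMeasure n p) =
      termMoment n s p z := by
  obtain ⟨u, v⟩ := z
  have hn' : (n : ℝ) ≠ 0 := by exact_mod_cast hn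
  by_cases huv : u = v
  · subst huv
    have h : ∀ x : Fin n → ℕ, symbolTerm s p u x * symbolTerm s p u x =
        ((n : ℝ)⁻¹) ^ 2 * (if nOcc x u = 1 then 1 else 0) +
          s ^ 2 * p u ^ 2 * (if nOcc x u = 0 then 1 else 0) := by
      intro x
      unfold symbolTerm
      split_ifs <;> first | omega | ring
    have hint : ∀ a, Integrable (fun x : Fin n → ℕ => if nOcc x u = a then (1 : ℝ) else 0)
        (sampleMeasure n p) := fun a =>
      integrable_sampleMeasure_of_bound hp 1 fun x => by split_ifs <;> simp
    simp_rw [h]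
    rw [integral_add ((hint 1).const_mul _) ((hint 0).const_mul _), integral_const_mul,
      integral_const_mul, integral_nOcc_eq_one hp, integral_nOcc_eq_zero hp, termMoment,
      if_pos rfl]
    field_simp
  · have h : ∀ x : Fin n → ℕ, symbolTerm s p u x * symbolTerm s p v x =
        ((n : ℝ)⁻¹) ^ 2 * ((if nOcc x u = 1 then 1 else 0) * (if nOcc x v = 1 then 1 else 0)) +
        (n : ℝ)⁻¹ * s * p v * ((if nOcc x u = 1 then 1 else 0) * (if nOcc x v = 0 then 1 else 0)) +
        (n : ℝ)⁻¹ * s * p u * ((if nOcc x v = 1 then 1 else 0) * (if nOcc x u = 0 then 1 else 0)) +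
        s ^ 2 * p u * p v *
          ((if nOcc x u = 0 then 1 else 0) * (if nOcc x v = 0 then 1 else 0)) := by
      intro x
      unfold symbolTerm
      ring
    have hint : ∀ a b c d, Integrable (fun x : Fin n → ℕ =>
        (if nOcc x c = a then (1 : ℝ) else 0) * (if nOcc x d = b then (1 : ℝ) else 0))
        (sampleMeasure n p) := fun a b c d =>
      integrable_sampleMeasure_of_bound hp 1 fun x => by split_ifs <;> simp
    simp_rw [h]
    rw [integral_add, integral_add, integral_add]
    · simp_rw [integral_const_mul]
      rw [integral_nOcc_eq_one_one hp n huv, integral_nOcc_eq_one_zero hp n huv,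
        integral_nOcc_eq_one_zero hp n (Ne.symm huv), integral_nOcc_eq_zero_zero hp n huv,
        termMoment, if_neg huv, sub_right_comm 1 (p v) (p u)]
      field_simp
      ring
    all_goals repeat' first | exact (hint _ _ _ _).const_mul _ | apply Integrable.add

lemma abs_symbolTerm {n : ℕ} {p : ℕ → ℝ} (hp : IsPMF p) (u : ℕ) (x : Fin n → ℕ) :
    |symbolTerm (-1) p u x| = symbolTerm 1 p u x := by
  have := hp.1 u
  unfold symbolTerm
  split_ifs <;> first | omega | simp [abs_of_nonneg this]

lemma IsPMF.le_one {p : ℕ → ℝ} (hp : IsPMF p) (u : ℕ) : p u ≤ 1 :=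
  le_hasSum hp.2 u fun v _ => hp.1 v

lemma IsPMF.add_le_one {p : ℕ → ℝ} (hp : IsPMF p) {u v : ℕ} (huv : u ≠ v) : p u + p v ≤ 1 := by
  rw [← Finset.sum_pair huv]
  exact sum_le_hasSum _ (fun v _ => hp.1 v) hp.2

lemma abs_symbolTerm_le {n : ℕ} {p : ℕ → ℝ} (hp : IsPMF p) (u : ℕ) (x : Fin n → ℕ) :
    |symbolTerm (-1) p u x| ≤ 1 := by
  rw [abs_symbolTerm hp]
  have := hp.le_one u
  have := Nat.cast_inv_le_one (α := ℝ) n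
  unfold symbolTerm
  split_ifs <;> first | omega | (simp; done) | simpa

lemma nOcc_ne_zero_iff {n : ℕ} (x : Fin n → ℕ) (u : ℕ) :
    nOcc x u ≠ 0 ↔ u ∈ Finset.univ.image x := by
  simp [nOcc_eq_zero_iff]

lemma hasSum_phi_one {n : ℕ} (x : Fin n → ℕ) :
    HasSum (fun u => if nOcc x u = 1 then (1 : ℝ) else 0) (phi 1 x) := by
  have h := hasSum_sum_of_ne_finset_zero (s := Finset.univ.image x) (L := .unconditional ℕ)
    (f := fun u => if nOcc x u = 1 then (1 : ℝ) else 0) (by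
      intro u hu
      rw [← nOcc_ne_zero_iff, not_not] at hu
      simp [hu])
  simpa [phi] using h

lemma IsPMF.summable_unseen {n : ℕ} {p : ℕ → ℝ} (hp : IsPMF p) (x : Fin n → ℕ) :
    Summable fun u => if nOcc x u = 0 then p u else 0 :=
  Summable.of_nonneg_of_le (fun u => by have := hp.1 u; split_ifs <;> simp [this])
    (fun u => by have := hp.1 u; split_ifs <;> simp [this]) hp.2.summable

lemma hasSum_symbolTerm {n : ℕ} {p : ℕ → ℝ} (hp : IsPMF p) (s : ℝ) (x : Fin n → ℕ) :
    HasSum (fun u => symbolTerm s p u x) (goodTuring x + s * missingMass p x) := by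
  have h := ((hasSum_phi_one x).mul_left (n : ℝ)⁻¹).add ((hp.summable_unseen x).hasSum.mul_left s)
  rw [goodTuring, div_eq_inv_mul]
  have hs : (fun u => symbolTerm s p u x) = fun u =>
      (n : ℝ)⁻¹ * (if nOcc x u = 1 then 1 else 0) + s * (if nOcc x u = 0 then p u else 0) := by
    ext u
    simp [symbolTerm]
  rwa [hs]

lemma sq_goodTuring_sub_missingMass {n : ℕ} {p : ℕ → ℝ} (hp : IsPMF p) (x : Fin n → ℕ) :
    (goodTuring x - missingMass p x) ^ 2 =
      ∑' z : ℕ × ℕ, symbolTerm (-1) p z.1 x * symbolTerm (-1) p z.2 x := by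
  have h := (hasSum_symbolTerm hp (-1) x).tsum_eq
  have hs : Summable fun u => ‖symbolTerm (-1) p u x‖ := by
    simpa [abs_symbolTerm hp] using (hasSum_symbolTerm hp 1 x).summable
  rw [← tsum_mul_tsum_of_summable_norm hs hs, h]
  ring

lemma goodTuring_nonneg {n : ℕ} (x : Fin n → ℕ) : 0 ≤ goodTuring x := by
  unfold goodTuring
  positivity

lemma goodTuring_le_one {n : ℕ} (x : Fin n → ℕ) : goodTuring x ≤ 1 := by
  refine div_le_one_of_le₀ ?_ n.cast_nonneg
  have h : phi 1 x ≤ n := (Finset.card_filter_le _ _).trans (Finset.card_image_le.trans (by simp))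
  exact_mod_cast h

lemma missingMass_nonneg {n : ℕ} {p : ℕ → ℝ} (hp : IsPMF p) (x : Fin n → ℕ) :
    0 ≤ missingMass p x :=
  tsum_nonneg fun u => by have := hp.1 u; split_ifs <;> simp [this]

lemma missingMass_le_one {n : ℕ} {p : ℕ → ℝ} (hp : IsPMF p) (x : Fin n → ℕ) :
    missingMass p x ≤ 1 := by
  rw [← hp.2.tsum_eq]
  refine (hp.summable_unseen x).tsum_le_tsum (fun u => ?_) hp.2.summable
  have := hp.1 u
  split_ifs <;> simp [this]

lemma hasSum_prod_diag {p : ℕ → ℝ} (hp : IsPMF p) :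
    HasSum (fun z : ℕ × ℕ => if z.1 = z.2 then p z.1 else 0) 1 := by
  have hinj : Function.Injective fun u : ℕ => (u, u) := fun u v h => (Prod.ext_iff.1 h).1
  refine (hinj.hasSum_iff ?_).1 (by simpa [Function.comp_def] using hp.2)
  rintro ⟨u, v⟩ h
  refine if_neg fun huv => h ⟨u, ?_⟩
  simpa using huv

lemma IsPMF.hasSum_prod {p : ℕ → ℝ} (hp : IsPMF p) :
    HasSum (fun z : ℕ × ℕ => p z.1 * p z.2) 1 := by
  simpa using hp.2.mul hp.2 (hp.2.summable.mul_of_nonneg hp.2.summable hp.1 hp.1)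

lemma termMoment_one_nonneg_le {n : ℕ} (hn : n ≠ 0) {p : ℕ → ℝ} (hp : IsPMF p) (z : ℕ × ℕ) :
    0 ≤ termMoment n 1 p z ∧
      termMoment n 1 p z ≤ 2 * (if z.1 = z.2 then p z.1 else 0) + 4 * (p z.1 * p z.2) := by
  obtain ⟨u, v⟩ := z
  have hu := hp.1 u
  have hv := hp.1 v
  have hu1 := hp.le_one u
  have hn1 : (1 : ℝ) ≤ n := by exact_mod_cast Nat.one_le_iff_ne_zero.2 hn
  have hni : (n : ℝ)⁻¹ ≤ 1 := Nat.cast_inv_le_one n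
  have hni0 : 0 ≤ (n : ℝ)⁻¹ := by positivity
  by_cases huv : u = v
  · subst huv
    have hq : 0 ≤ 1 - p u := by linarith
    have h1 := pow_le_one₀ (n := n - 1) hq (by linarith)
    have h2 := pow_le_one₀ (n := n) hq (by linarith)
    have h3 : p u * (1 - p u) ^ (n - 1) / n ≤ p u :=
      (div_le_self (by positivity) hn1).trans (mul_le_of_le_one_right hu h1)
    have h4 : p u ^ 2 * (1 - p u) ^ n ≤ p u ^ 2 := mul_le_of_le_one_right (by positivity) h2
    simp only [termMoment, if_true]
    refine ⟨by positivity, ?_⟩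
    nlinarith
  · have hr : 0 ≤ 1 - p u - p v := by linarith [hp.add_le_one huv]
    have h1 := pow_le_one₀ (n := n - 2) hr (by linarith)
    have h2 := pow_le_one₀ (n := n - 1) hr (by linarith)
    have h3 := pow_le_one₀ (n := n) hr (by linarith)
    have h4 : (1 - (n : ℝ)⁻¹) * (1 - p u - p v) ^ (n - 2) ≤ 1 :=
      mul_le_one₀ (by linarith) (by positivity) h1
    have h5 : 0 ≤ 1 - (n : ℝ)⁻¹ := by linarith
    simp only [termMoment, huv, if_false]
    refine ⟨by positivity, ?_⟩
    rw [mul_zero, zero_add, mul_comm 4]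
    exact mul_le_mul_of_nonneg_left (by linarith) (by positivity)

/-- The risk of the Good-Turing estimator as a sum over pairs of symbols. -/
lemma risk_goodTuring_eq_tsum {n : ℕ} (hn : n ≠ 0) {p : ℕ → ℝ} (hp : IsPMF p) :
    risk n p goodTuring = ∑' z, termMoment n (-1) p z := by
  rw [risk, expct_eq_integral hp]
  · simp_rw [sq_goodTuring_sub_missingMass hp, ← integral_symbolTerm_mul hn (-1) hp]
    refine (integral_tsum_of_summable_integral_norm (fun z => ?_) ?_).symm
    · refine integrable_sampleMeasure_of_bound hp 1 fun x => ?_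
      rw [abs_mul]
      exact mul_le_one₀ (abs_symbolTerm_le hp _ x) (abs_nonneg _) (abs_symbolTerm_le hp _ x)
    · simp_rw [norm_mul, Real.norm_eq_abs, abs_symbolTerm hp, integral_symbolTerm_mul hn 1 hp]
      exact Summable.of_nonneg_of_le (fun z => (termMoment_one_nonneg_le hn hp z).1)
        (fun z => (termMoment_one_nonneg_le hn hp z).2)
        (((hasSum_prod_diag hp).summable.mul_left 2).add (hp.hasSum_prod.summable.mul_left 4))
  · refine integrable_sampleMeasure_of_bound hp 1 fun x => ?_
    rw [abs_of_nonneg (sq_nonneg _), sq_le_one_iff_abs_le_one, abs_le]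
    constructor <;> linarith [goodTuring_nonneg x, goodTuring_le_one x, missingMass_nonneg hp x,
      missingMass_le_one hp x]

lemma succ_mul_mul_one_sub_pow_le_one (m : ℕ) {t : ℝ} (h0 : 0 ≤ t) (h1 : t ≤ 1) :
    ((m : ℝ) + 1) * (t * (1 - t) ^ m) ≤ 1 := by
  have hB : 1 + (m : ℝ) * t ≤ (1 + t) ^ m := one_add_mul_le_pow (by linarith) m
  have hprod : (1 - t) ^ m * (1 + t) ^ m ≤ 1 := by
    rw [← mul_pow]
    exact pow_le_one₀ (by nlinarith) (by nlinarith)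
  have hpow : 0 ≤ (1 - t) ^ m := pow_nonneg (by linarith) m
  calc ((m : ℝ) + 1) * (t * (1 - t) ^ m) ≤ (1 - t) ^ m * (1 + m * t) := by
        nlinarith [mul_nonneg hpow (sub_nonneg.2 h1)]
    _ ≤ (1 - t) ^ m * (1 + t) ^ m := mul_le_mul_of_nonneg_left hB hpow
    _ ≤ 1 := hprod

lemma abs_termMoment_le {n : ℕ} (hn : 2 ≤ n) {p : ℕ → ℝ} (hp : IsPMF p) (z : ℕ × ℕ) :
    |termMoment n (-1) p z| ≤
      2 / n * (if z.1 = z.2 then p z.1 else 0) + 3 / n * (p z.1 * p z.2) := by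
  obtain ⟨u, v⟩ := z
  obtain ⟨m, rfl⟩ := Nat.exists_eq_add_of_le' hn
  have hu := hp.1 u
  have hv := hp.1 v
  have hu1 := hp.le_one u
  have hn0 : (0 : ℝ) < (m + 2 : ℕ) := by positivity
  by_cases huv : u = v
  · subst huv
    have hq : 0 ≤ 1 - p u := by linarith
    have h1 := pow_le_one₀ (n := m + 1) hq (by linarith)
    have h2 := succ_mul_mul_one_sub_pow_le_one (m + 2) hu hu1
    have h2' : ((m + 2 : ℕ) : ℝ) * (p u * (1 - p u) ^ (m + 2)) ≤ 1 := by
      nlinarith [mul_nonneg hu (pow_nonneg hq (m + 2))]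
    have h3 : ((m + 2 : ℕ) : ℝ) * (p u ^ 2 * (1 - p u) ^ (m + 2)) ≤ p u := by
      nlinarith [mul_le_mul_of_nonneg_left h2' hu]
    have h4 : p u * (1 - p u) ^ (m + 1) ≤ p u := mul_le_of_le_one_right hu h1
    simp only [termMoment, if_true, show m + 2 - 1 = m + 1 by omega]
    rw [abs_of_nonneg (by positivity)]
    refine le_trans (b := 2 / ((m + 2 : ℕ) : ℝ) * p u) ?_ (le_add_of_nonneg_right (by positivity))
    rw [div_mul_eq_mul_div, le_div_iff₀ hn0, add_mul, div_mul_cancel₀ _ hn0.ne']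
    linarith
  · have hs := hp.add_le_one huv
    have hr : 0 ≤ 1 - p u - p v := by linarith
    have h1 := pow_le_one₀ (n := m) hr (by linarith)
    have h2 := succ_mul_mul_one_sub_pow_le_one m (add_nonneg hu hv) hs
    rw [← sub_sub] at h2
    simp only [termMoment, huv, if_false, show m + 2 - 1 = m + 1 by omega,
      show m + 2 - 2 = m by omega, mul_zero, zero_add]
    have h0 : 0 ≤ (1 - p u - p v) ^ m := pow_nonneg hr m
    have key : (1 - (((m + 2 : ℕ) : ℝ))⁻¹) * (1 - p u - p v) ^ m
        + 2 * -1 * (1 - p u - p v) ^ (m + 1) + (-1) ^ 2 * (1 - p u - p v) ^ (m + 2) =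
        (p u + p v) * ((p u + p v) * (1 - p u - p v) ^ m)
          - (1 - p u - p v) ^ m / ((m + 2 : ℕ) : ℝ) := by
      ring
    rw [key, abs_mul, abs_of_nonneg (mul_nonneg hu hv), mul_comm (3 / _)]
    refine mul_le_mul_of_nonneg_left ?_ (mul_nonneg hu hv)
    have h3 : (p u + p v) * ((p u + p v) * (1 - p u - p v) ^ m) ≤ 2 / ((m + 2 : ℕ) : ℝ) := by
      rw [le_div_iff₀ hn0]
      push_cast
      have h4 : 0 ≤ (p u + p v) * (1 - p u - p v) ^ m := by positivity
      have h5 : (p u + p v) * ((p u + p v) * (1 - p u - p v) ^ m) ≤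
          (p u + p v) * (1 - p u - p v) ^ m := mul_le_of_le_one_left h4 hs
      have hm : (0 : ℝ) ≤ m := m.cast_nonneg
      nlinarith
    have h6 : (1 - p u - p v) ^ m / ((m + 2 : ℕ) : ℝ) ≤ 1 / ((m + 2 : ℕ) : ℝ) := by gcongr
    have h7 : 0 ≤ (1 - p u - p v) ^ m / ((m + 2 : ℕ) : ℝ) := by positivity
    have h8 : 0 ≤ (p u + p v) * ((p u + p v) * (1 - p u - p v) ^ m) := by positivity
    have h9 : 3 / ((m + 2 : ℕ) : ℝ) = 2 / ((m + 2 : ℕ) : ℝ) + 1 / ((m + 2 : ℕ) : ℝ) := by ring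
    have h10 : 0 ≤ 1 / ((m + 2 : ℕ) : ℝ) := by positivity
    rw [abs_le]
    constructor <;> linarith

lemma risk_goodTuring_le {n : ℕ} (hn : 2 ≤ n) {p : ℕ → ℝ} (hp : IsPMF p) :
    risk n p goodTuring ≤ 5 / n := by
  rw [risk_goodTuring_eq_tsum (by omega) hp]
  have h := ((hasSum_prod_diag hp).mul_left (2 / (n : ℝ))).add
    (hp.hasSum_prod.mul_left (3 / (n : ℝ)))
  have hsum : Summable fun z => termMoment n (-1) p z :=
    Summable.of_norm_bounded h.summable fun z => abs_termMoment_le hn hp z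
  calc _ ≤ _ := hasSum_le (fun z => (le_abs_self _).trans (abs_termMoment_le hn hp z)) hsum.hasSum h
    _ = 5 / n := by ring

/-- The uniform distribution on `{0, …, K - 1}`. -/
def uniformPMF (K : ℕ) (u : ℕ) : ℝ := if u < K then (K : ℝ)⁻¹ else 0

lemma isPMF_uniformPMF {K : ℕ} (hK : K ≠ 0) : IsPMF (uniformPMF K) := by
  refine ⟨fun u => by unfold uniformPMF; positivity, ?_⟩
  have h := hasSum_sum_of_ne_finset_zero (s := Finset.range K) (f := uniformPMF K)
    (L := .unconditional ℕ) fun u hu => if_neg (by simpa using hu)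
  rwa [Finset.sum_congr rfl (g := fun _ => (K : ℝ)⁻¹), Finset.sum_const, Finset.card_range,
    nsmul_eq_mul, mul_inv_cancel₀ (by exact_mod_cast hK)] at h
  exact fun u hu => if_pos (by simpa using hu)

lemma risk_uniformPMF {n K : ℕ} (hn : n ≠ 0) (hK : K ≠ 0) :
    risk n (uniformPMF K) goodTuring =
      (1 - (K : ℝ)⁻¹) ^ (n - 1) / n + (1 - (K : ℝ)⁻¹) ^ n / K +
      (1 - (K : ℝ)⁻¹) * ((1 - (n : ℝ)⁻¹) * (1 - 2 * (K : ℝ)⁻¹) ^ (n - 2)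
        - 2 * (1 - 2 * (K : ℝ)⁻¹) ^ (n - 1) + (1 - 2 * (K : ℝ)⁻¹) ^ n) := by
  have hK' : (K : ℝ) ≠ 0 := by exact_mod_cast hK
  rw [risk_goodTuring_eq_tsum hn (isPMF_uniformPMF hK),
    tsum_eq_sum (s := Finset.range K ×ˢ Finset.range K), Finset.sum_product]
  · set A : ℝ := (K : ℝ)⁻¹ * (1 - (K : ℝ)⁻¹) ^ (n - 1) / n +
      (-1) ^ 2 * (K : ℝ)⁻¹ ^ 2 * (1 - (K : ℝ)⁻¹) ^ n with hA
    set B : ℝ := (K : ℝ)⁻¹ * (K : ℝ)⁻¹ * ((1 - (n : ℝ)⁻¹) * (1 - (K : ℝ)⁻¹ - (K : ℝ)⁻¹) ^ (n - 2)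
      + 2 * -1 * (1 - (K : ℝ)⁻¹ - (K : ℝ)⁻¹) ^ (n - 1)
      + (-1) ^ 2 * (1 - (K : ℝ)⁻¹ - (K : ℝ)⁻¹) ^ n) with hB
    have h : ∀ u ∈ Finset.range K, ∀ v ∈ Finset.range K,
        termMoment n (-1) (uniformPMF K) (u, v) = (if u = v then A - B else 0) + B := by
      intro u hu v hv
      rw [Finset.mem_range] at hu hv
      simp only [termMoment, uniformPMF, hu, hv, if_true]
      split_ifs <;> simp [hA, hB]
    have h' : ∀ u ∈ Finset.range K, ∑ v ∈ Finset.range K,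
        termMoment n (-1) (uniformPMF K) (u, v) = A - B + K * B := by
      intro u hu
      rw [Finset.sum_congr rfl (h u hu), Finset.sum_add_distrib, Finset.sum_ite_eq, if_pos hu]
      simp
    rw [Finset.sum_congr rfl h', Finset.sum_const, Finset.card_range, nsmul_eq_mul, hA, hB]
    rw [show (1 : ℝ) - (K : ℝ)⁻¹ - (K : ℝ)⁻¹ = 1 - 2 * (K : ℝ)⁻¹ by ring]
    generalize (1 - 2 * (K : ℝ)⁻¹) ^ n = a
    generalize (1 - 2 * (K : ℝ)⁻¹) ^ (n - 1) = b
    generalize (1 - 2 * (K : ℝ)⁻¹) ^ (n - 2) = c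
    generalize (1 - (K : ℝ)⁻¹) ^ n = d
    generalize (1 - (K : ℝ)⁻¹) ^ (n - 1) = e
    field_simp
    ring
  · rintro ⟨u, v⟩ h
    rw [Finset.mem_product, Finset.mem_range, Finset.mem_range, not_and_or] at h
    rcases h with h | h
    · simp [termMoment, uniformPMF, show ¬ u < K from h]
    · by_cases huv : u = v
      · subst huv
        simp [termMoment, uniformPMF, show ¬ u < K from h]
      · simp [termMoment, huv, uniformPMF, show ¬ v < K from h]

/-- For `n ≥ 2` and `K ≥ 3`, the risk under the uniform distribution in terms of `n`-th powers. -/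
lemma mul_risk_uniformPMF {n K : ℕ} (hn : 2 ≤ n) (hK : 3 ≤ K) :
    n * risk n (uniformPMF K) goodTuring =
      (1 + -(K : ℝ)⁻¹) ^ n / (1 - (K : ℝ)⁻¹) + n / K * (1 + -(K : ℝ)⁻¹) ^ n +
      (1 - (K : ℝ)⁻¹) * ((1 + -(2 * (K : ℝ)⁻¹)) ^ n / (1 - 2 * (K : ℝ)⁻¹) ^ 2) *
        (4 * (n / K) * (K : ℝ)⁻¹ - 1) := by
  obtain ⟨m, rfl⟩ := Nat.exists_eq_add_of_le' hn
  have hK3 : (3 : ℝ) ≤ K := by exact_mod_cast hK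
  have hK0 : (K : ℝ) ≠ 0 := by positivity
  have hn0 : ((m + 2 : ℕ) : ℝ) ≠ 0 := by positivity
  have h1 : 1 - (K : ℝ)⁻¹ ≠ 0 := by
    have : (K : ℝ)⁻¹ ≤ 3⁻¹ := inv_anti₀ (by norm_num) hK3
    norm_num at this
    linarith
  have h2 : 1 - 2 * (K : ℝ)⁻¹ ≠ 0 := by
    have : (K : ℝ)⁻¹ ≤ 3⁻¹ := inv_anti₀ (by norm_num) hK3
    norm_num at this
    linarith
  rw [risk_uniformPMF (by omega) (by omega), ← sub_eq_add_neg, ← sub_eq_add_neg,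
    show m + 2 - 1 = m + 1 by omega, show m + 2 - 2 = m by omega,
    pow_succ (1 - (K : ℝ)⁻¹) (m + 1), mul_div_cancel_right₀ _ h1,
    pow_add (1 - 2 * (K : ℝ)⁻¹) m 2, mul_div_cancel_right₀ _ (pow_ne_zero 2 h2),
    pow_succ (1 - 2 * (K : ℝ)⁻¹) m]
  generalize ((m + 2 : ℕ) : ℝ) = N at *
  generalize (1 - 2 * (K : ℝ)⁻¹) ^ m = a
  generalize (1 - (K : ℝ)⁻¹) ^ (m + 1) = d
  field_simp
  ring

open Filter Topology in
lemma tendsto_mul_risk_uniformPMF {c : ℝ} (hc : 0 < c) :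
    Tendsto (fun n : ℕ => (n : ℝ) * risk n (uniformPMF ⌈c * n⌉₊) goodTuring) atTop
      (𝓝 ((1 / c + 1) * Real.exp (-1 / c) - Real.exp (-2 / c))) := by
  set K : ℕ → ℕ := fun n => ⌈c * n⌉₊ with hKdef
  have hK : Tendsto K atTop atTop :=
    tendsto_nat_ceil_atTop.comp (tendsto_natCast_atTop_atTop.const_mul_atTop hc)
  have hKinv : Tendsto (fun n => ((K n : ℕ) : ℝ)⁻¹) atTop (𝓝 0) :=
    tendsto_inv_atTop_zero.comp (tendsto_natCast_atTop_atTop.comp hK)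
  have hnK : Tendsto (fun n : ℕ => (n : ℝ) / K n) atTop (𝓝 (1 / c)) := by
    have h := ((tendsto_nat_ceil_mul_div_atTop hc.le).comp
      (tendsto_natCast_atTop_atTop (R := ℝ))).inv₀ hc.ne'
    simpa [Function.comp_def] using h
  have h1 : Tendsto (fun n : ℕ => (1 + -((K n : ℕ) : ℝ)⁻¹) ^ n) atTop (𝓝 (Real.exp (-1 / c))) := by
    refine Real.tendsto_one_add_pow_exp_of_tendsto ?_
    simpa [div_eq_mul_inv] using hnK.neg
  have h2 : Tendsto (fun n : ℕ => (1 + -(2 * ((K n : ℕ) : ℝ)⁻¹)) ^ n) atTop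
      (𝓝 (Real.exp (-2 / c))) := by
    refine Real.tendsto_one_add_pow_exp_of_tendsto ?_
    convert (hnK.const_mul (-2)) using 2 <;> ring
  have hlim := ((h1.div (tendsto_const_nhds.sub hKinv) (by norm_num : (1 : ℝ) - 0 ≠ 0)).add
    (hnK.mul h1)).add (((tendsto_const_nhds (x := (1 : ℝ))).sub hKinv).mul
      (h2.div (((tendsto_const_nhds (x := (1 : ℝ))).sub (hKinv.const_mul 2)).pow 2)
        (by norm_num)) |>.mul (((hnK.const_mul 4).mul hKinv).sub (tendsto_const_nhds (x := (1 : ℝ)))))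
  refine (hlim.congr' ?_).trans (le_of_eq ?_)
  · filter_upwards [eventually_ge_atTop 2, hK.eventually_ge_atTop 3] with n hn hn'
    exact (mul_risk_uniformPMF hn hn').symm
  · congr 1
    ring

/-- **Lower bound on the worst-case risk of the Good-Turing estimator:**
for every `c > 0`,
`liminf_{n→∞} n · sup_p R_n(M^GT, p) ≥ (1/c + 1) e^{-1/c} - e^{-2/c}`. -/
theorem goodTuring_worst_risk_liminf_ge (c : ℝ) (hc : 0 < c) :
    (1 / c + 1) * Real.exp (-1 / c) - Real.exp (-2 / c) ≤
      Filter.liminf (fun n : ℕ => (n : ℝ) * gtWorstRisk n) Filter.atTop := by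
  have hub : ∀ n : ℕ, 2 ≤ n → ∀ r ∈ {r : ℝ | ∃ p : ℕ → ℝ, IsPMF p ∧ r = risk n p goodTuring},
      r ≤ 5 / n := by
    rintro n hn _ ⟨p, hp, rfl⟩
    exact risk_goodTuring_le hn hp
  rw [← (tendsto_mul_risk_uniformPMF hc).liminf_eq]
  refine Filter.liminf_le_liminf ?_ (tendsto_mul_risk_uniformPMF hc).isBoundedUnder_ge ?_
  · filter_upwards [Filter.eventually_ge_atTop 2] with n hn
    refine mul_le_mul_of_nonneg_left (le_csSup ⟨_, hub n hn⟩ ⟨_, isPMF_uniformPMF ?_, rfl⟩)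
      n.cast_nonneg
    have : 0 < ⌈c * n⌉₊ := Nat.ceil_pos.2 (by positivity)
    omega
  · refine Filter.IsBoundedUnder.isCoboundedUnder_ge ⟨5, ?_⟩
    rw [Filter.eventually_map]
    filter_upwards [Filter.eventually_ge_atTop 2] with n hn
    have hn0 : (0 : ℝ) < n := by positivity
    rw [mul_comm, ← le_div_iff₀ hn0]
    exact csSup_le ⟨_, _, isPMF_uniformPMF one_ne_zero, rfl⟩ (hub n hn)
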